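/- arXiv:2602.04644 — 2 statements merged into one kernel-verified Lean document; each statement's English description precedes it below -/
import Mathlib

section
/- Let d, N ∈ ℕ, set n = N·d, let De > 0, let L ∈ Matrix n n ℝ be diagonal with strictly positive diagonal entries, and let u : ℝ × (Fin d → ℝ) → (Fin d → ℝ) be continuously differentiable. For (t, x) let J(t,x) ∈ Matrix d d ℝ be the spatial Jacobian of u, J(t,x)ᵢⱼ = ∂uᵢ/∂xⱼ(t,x), let G(t,x) = (1 : Matrix N N ℝ) ⊗ J(t,x) ∈ Matrix n n ℝ be its Kronecker product with the N×N identity, and let M(t,x) = (1/(2·De))·L − G(t,x). Suppose C : ℝ × (Fin d → ℝ) → Matrix n n ℝ is differentiable, takes symmetric positive definite values satisfying C(t,x) * L = L * C(t,x), and solves ∂ₜC + ∑ᵢ uᵢ ∂C/∂xᵢ = (1/De)·L − C * M(t,x)ᵀ − M(t,x) * C for all (t, x). Define f(t, x, q) = Φ(C(t,x), q). Then f is an exact solution of the Hookean Fokker–Planck equation without center-of-mass diffusion: for all (t, x, q), ∂ₜf + ∑ᵢ uᵢ ∂f/∂xᵢ + div_q( G(t,x) q · f − (1/(2·De)) ·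 L • (q · f + ∇_q f) ) = 0, where div_q W = ∑ₖ ∂Wₖ/∂qₖ and ∇_q f is the gradient of f in the q variables. -/
open Matrix Real Kronecker

/-- The quadratic form `qᵀ B q = ∑ᵢⱼ qᵢ Bᵢⱼ qⱼ` of a matrix `B`. -/
noncomputable def quadForm {ι : Type*} [Fintype ι] (B : Matrix ι ι ℝ) (q : ι → ℝ) : ℝ :=
  ∑ i, ∑ j, q i * B i j * q j

/-- The centered Gaussian probability density with covariance matrix `C`,
`Φ(C, q) = exp(−(1/2) qᵀ C⁻¹ q) / √((2π)ⁿ det C)`, with `n` the number of variables. -/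
noncomputable def gaussPdf {ι : Type*} [Fintype ι] [DecidableEq ι]
    (C : Matrix ι ι ℝ) (q : ι → ℝ) : ℝ :=
  Real.exp (-(1 / 2) * quadForm C⁻¹ q) /
    Real.sqrt ((2 * Real.pi) ^ Fintype.card ι * C.det)

/-- The spatial Jacobian `J(t,x)ᵢⱼ = ∂uᵢ/∂xⱼ(t,x)` of a velocity field. -/
noncomputable def jacb {d : ℕ} (u : ℝ → (Fin d → ℝ) → (Fin d → ℝ)) (t : ℝ)
    (x : Fin d → ℝ) : Matrix (Fin d) (Fin d) ℝ :=
  Matrix.of fun i j => fderiv ℝ (fun y => u t y i) x (Pi.single j 1)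

/-- The determinant as a continuous multilinear map of the rows. -/
noncomputable def detCML (ι : Type*) [Fintype ι] [DecidableEq ι] :
    ContinuousMultilinearMap ℝ (fun _ : ι => ι → ℝ) ℝ :=
  { (Matrix.detRowAlternating (n := ι) (R := ℝ)).toMultilinearMap with
    cont := by
      change Continuous fun A : ι → ι → ℝ => Matrix.det (Matrix.of A)
      exact Continuous.matrix_det continuous_id }

theorem detCML_apply {ι : Type*} [Fintype ι] [DecidableEq ι] (A : Matrix ι ι ℝ) :
    detCML ι (fun i => A i) = A.det := rfl

section
variable {ι : Type*} [Fintype ι] [DecidableEq ι]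
  {E : Type*} [NormedAddCommGroup E] [NormedSpace ℝ E]

theorem det_updateRow_eq (A : Matrix ι ι ℝ) (i : ι) (b : ι → ℝ) :
    (A.updateRow i b).det = ∑ j, b j * A.adjugate j i := by
  rw [← cramer_transpose_apply, cramer_eq_adjugate_mulVec, ← adjugate_transpose]
  simp [mulVec, dotProduct, mul_comm]

theorem hasFDerivAt_det_entries {A : E → Matrix ι ι ℝ} {A' : ι → ι → E →L[ℝ] ℝ} {x : E}
    (hA : ∀ k l, HasFDerivAt (fun y => A y k l) (A' k l) x) :
    HasFDerivAt (fun y => (A y).det) (∑ k, ∑ l, (A x).adjugate l k • A' k l) x := by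
  have h1 : HasFDerivAt (fun y => (fun i j => A y i j : ι → ι → ℝ))
      (ContinuousLinearMap.pi fun i => ContinuousLinearMap.pi fun j => A' i j) x :=
    hasFDerivAt_pi.2 fun i => hasFDerivAt_pi.2 fun j => hA i j
  have h2 := ((detCML ι).hasFDerivAt (fun i j => A x i j)).comp x h1
  refine h2.congr_fderiv ?_
  ext v
  simp only [ContinuousLinearMap.comp_apply, ContinuousMultilinearMap.linearDeriv_apply]
  simp only [_root_.sum_apply, _root_.smul_apply, smul_eq_mul]
  refine Finset.sum_congr rfl fun i _ => ?_
  have := det_updateRow_eq (A x) i (fun j => A' i j v)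
  refine Eq.trans this ?_
  exact Finset.sum_congr rfl fun j _ => mul_comm _ _

theorem differentiableAt_inv_entry {A : E → Matrix ι ι ℝ} {x : E}
    (hA : ∀ k l, DifferentiableAt ℝ (fun y => A y k l) x) (hx : (A x).det ≠ 0) (k l : ι) :
    DifferentiableAt ℝ (fun y => (A y)⁻¹ k l) x := by
  have hdet : DifferentiableAt ℝ (fun y => (A y).det) x :=
    (hasFDerivAt_det_entries fun k l => (hA k l).hasFDerivAt).differentiableAt
  have hadj : DifferentiableAt ℝ (fun y => (A y).adjugate k l) x := by
    simp only [adjugate_apply]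
    refine (hasFDerivAt_det_entries
      (A' := fun i j => fderiv ℝ (fun y => (A y).updateRow l (Pi.single k 1) i j) x)
      fun i j => DifferentiableAt.hasFDerivAt ?_).differentiableAt
    by_cases h : i = l
    · subst h; simp
    · simpa [updateRow_ne h] using hA i j
  have : (fun y => (A y)⁻¹ k l) = fun y => ((A y).det)⁻¹ * (A y).adjugate k l := by
    funext y
    simp [Matrix.inv_def]
  rw [this]
  exact (hdet.inv hx).mul hadj

theorem hasFDerivAt_inv_entry {A : E → Matrix ι ι ℝ} {A' : ι → ι → E →L[ℝ] ℝ} {x : E}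
    (hA : ∀ k l, HasFDerivAt (fun y => A y k l) (A' k l) x) (hdet : ∀ y, (A y).det ≠ 0)
    (i j : ι) :
    HasFDerivAt (fun y => (A y)⁻¹ i j)
      (∑ k, ∑ l, (-((A x)⁻¹ i k * (A x)⁻¹ l j)) • A' k l) x := by
  have hd := fun k l => differentiableAt_inv_entry (fun k l => (hA k l).differentiableAt) (hdet x) k l
  refine (hd i j).hasFDerivAt.congr_fderiv ?_
  ext v
  set P := (A x)⁻¹ with hP
  let Pd : Matrix ι ι ℝ := of fun k l => fderiv ℝ (fun y => (A y)⁻¹ k l) x v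
  let Ad : Matrix ι ι ℝ := of fun k l => A' k l v
  have key : A x * Pd + Ad * P = 0 := by
    ext a b
    have h1 : HasFDerivAt (fun y => ∑ c, A y a c * (A y)⁻¹ c b)
        (∑ c, (A x a c • fderiv ℝ (fun y => (A y)⁻¹ c b) x + (A x)⁻¹ c b • A' a c)) x :=
      HasFDerivAt.fun_sum fun c _ => (hA a c).mul (hd c b).hasFDerivAt
    have h2 : (fun y => ∑ c, A y a c * (A y)⁻¹ c b) = fun _ => (1 : Matrix ι ι ℝ) a b := by
      funext y
      rw [← mul_apply, mul_nonsing_inv _ (isUnit_iff_ne_zero.2 (hdet y))]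
    rw [h2] at h1
    have h3 := congrArg (fun T => T v) (h1.unique (hasFDerivAt_const _ _))
    simp only [_root_.sum_apply, _root_.add_apply,
      _root_.smul_apply, smul_eq_mul, _root_.zero_apply] at h3
    simp only [Matrix.add_apply, Matrix.mul_apply, Pd, Ad, of_apply, Matrix.zero_apply, ← Finset.sum_add_distrib]
    rw [← h3]
    exact Finset.sum_congr rfl fun c _ => by ring
  have key2 : Pd = - (P * Ad * P) := by
    have : P * (A x * Pd + Ad * P) = 0 := by rw [key, mul_zero]
    rw [mul_add, ← mul_assoc, hP, nonsing_inv_mul _ (isUnit_iff_ne_zero.2 (hdet x)), one_mul,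
      ← mul_assoc] at this
    exact eq_neg_of_add_eq_zero_left this
  have key3 := congrFun (congrFun key2 i) j
  change Pd i j = _
  rw [key3]
  simp only [Matrix.neg_apply, Matrix.mul_apply, _root_.sum_apply, _root_.smul_apply,
    smul_eq_mul, Ad, of_apply, Finset.sum_mul, neg_mul, Finset.sum_neg_distrib]
  rw [Finset.sum_comm]
  congr 1
  exact Finset.sum_congr rfl fun c _ => Finset.sum_congr rfl fun c' _ => by ring

theorem hasFDerivAt_gaussPdf_cov {A : E → Matrix ι ι ℝ} {A' : ι → ι → E →L[ℝ] ℝ} {x : E}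
    (hA : ∀ k l, HasFDerivAt (fun y => A y k l) (A' k l) x) (hpos : ∀ y, (A y).PosDef)
    (q : ι → ℝ) :
    HasFDerivAt (fun y => gaussPdf (A y) q)
      (gaussPdf (A x) q • ∑ k, ∑ l,
        ((1 / 2) * (((A x)⁻¹ *ᵥ q) k * ((A x)⁻¹ *ᵥ q) l) - (1 / 2) * (A x)⁻¹ l k) • A' k l) x := by
  have hdet : ∀ y, (A y).det ≠ 0 := fun y => (hpos y).det_pos.ne'
  have hinv := fun i j => hasFDerivAt_inv_entry hA hdet i j
  have hD := hasFDerivAt_det_entries hA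
  have hQ : HasFDerivAt (fun y => quadForm (A y)⁻¹ q)
      (-∑ k, ∑ l, (((A x)⁻¹ *ᵥ q) k * ((A x)⁻¹ *ᵥ q) l) • A' k l) x := by
    unfold quadForm
    have h := HasFDerivAt.fun_sum (u := Finset.univ) fun i _ => HasFDerivAt.fun_sum (u := Finset.univ) fun j _ =>
      ((hinv i j).const_mul (q i)).mul_const (q j)
    refine h.congr_fderiv ?_
    ext v
    have hs : ∀ i k, (A x)⁻¹ i k = (A x)⁻¹ k i := fun i k => by
      have := (hpos x).isHermitian.inv
      simpa using (this.apply i k).symm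
    simp only [_root_.sum_apply, _root_.smul_apply,
      _root_.neg_apply, smul_eq_mul, mulVec, dotProduct,
      Finset.sum_mul, Finset.mul_sum, ← Finset.sum_neg_distrib]
    have e : ∀ F : ι → ι → ι → ι → ℝ, ∑ i, ∑ j, ∑ k, ∑ l, F i j k l
        = ∑ k, ∑ l, ∑ j, ∑ i, F i j k l := by
      intro F
      calc _ = ∑ i, ∑ k, ∑ j, ∑ l, F i j k l :=
            Finset.sum_congr rfl fun i _ => Finset.sum_comm
        _ = ∑ k, ∑ i, ∑ j, ∑ l, F i j k l := Finset.sum_comm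
        _ = ∑ k, ∑ i, ∑ l, ∑ j, F i j k l :=
            Finset.sum_congr rfl fun k _ => Finset.sum_congr rfl fun i _ => Finset.sum_comm
        _ = ∑ k, ∑ l, ∑ i, ∑ j, F i j k l := Finset.sum_congr rfl fun k _ => Finset.sum_comm
        _ = _ := Finset.sum_congr rfl fun k _ => Finset.sum_congr rfl fun l _ => Finset.sum_comm
    rw [e]
    refine Finset.sum_congr rfl fun k _ => Finset.sum_congr rfl fun l _ =>
      Finset.sum_congr rfl fun j _ => Finset.sum_congr rfl fun i _ => ?_
    rw [hs i k]
    ring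
  set K : ℝ := (2 * Real.pi) ^ Fintype.card ι with hK
  have hKpos : 0 < K := by positivity
  have hdp : 0 < K * (A x).det := mul_pos hKpos (hpos x).det_pos
  have hS := (hD.const_mul K).sqrt hdp.ne'
  have hE := (hQ.const_mul (-(1 / 2))).exp
  have hI := (hasDerivAt_inv (Real.sqrt_pos.2 hdp).ne').comp_hasFDerivAt x hS
  have h := hE.fun_mul hI
  have hadj : ∀ k l, (A x).adjugate l k = (A x).det * (A x)⁻¹ l k := fun k l => by
    simp [Matrix.inv_def, hdet x]
  unfold gaussPdf
  simp only [div_eq_mul_inv (Real.exp _)]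
  refine h.congr_fderiv ?_
  ext v
  have e1 : (∑ k, ∑ l, (A x).adjugate l k • A' k l) v
      = (A x).det * ∑ k, ∑ l, (A x)⁻¹ l k * A' k l v := by
    simp only [_root_.sum_apply, _root_.smul_apply, smul_eq_mul, hadj,
      Finset.mul_sum, mul_assoc]
  have e2 : (∑ k, ∑ l,
        ((1 / 2) * (((A x)⁻¹ *ᵥ q) k * ((A x)⁻¹ *ᵥ q) l) - (1 / 2) * (A x)⁻¹ l k) • A' k l) v
      = (1 / 2) * (∑ k, ∑ l, (((A x)⁻¹ *ᵥ q) k * ((A x)⁻¹ *ᵥ q) l) • A' k l) v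
        - (1 / 2) * ∑ k, ∑ l, (A x)⁻¹ l k * A' k l v := by
    simp only [_root_.sum_apply, _root_.smul_apply, smul_eq_mul,
      Finset.mul_sum, ← Finset.sum_sub_distrib]
    exact Finset.sum_congr rfl fun c _ => Finset.sum_congr rfl fun c' _ => by ring
  simp only [_root_.smul_apply, _root_.add_apply,
    _root_.neg_apply, smul_eq_mul, Function.comp_apply]
  rw [e1, e2]
  generalize (∑ k, ∑ l, (A x)⁻¹ l k * A' k l v) = T1
  generalize (∑ k, ∑ l, (((A x)⁻¹ *ᵥ q) k * ((A x)⁻¹ *ᵥ q) l) • A' k l) v = T2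
  set s := Real.sqrt (K * (A x).det) with hs
  have hsp : 0 < s := Real.sqrt_pos.2 hdp
  have hss : s ^ 2 = K * (A x).det := Real.sq_sqrt hdp.le
  have : K * ((A x).det * T1) = s ^ 2 * T1 := by rw [hss]; ring
  rw [this]
  field_simp
  ring

theorem hasFDerivAt_gaussPdf_q {C : Matrix ι ι ℝ} (hC : C.PosDef) (p : ι → ℝ) :
    HasFDerivAt (fun r => gaussPdf C r)
      ((-gaussPdf C p) • ∑ k, (C⁻¹ *ᵥ p) k • ContinuousLinearMap.proj (R := ℝ) (φ := fun _ : ι => ℝ) k) p := by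
  have hs : ∀ i k, C⁻¹ i k = C⁻¹ k i := fun i k => by
    simpa using (hC.isHermitian.inv.apply i k).symm
  have hQ : HasFDerivAt (fun r => quadForm C⁻¹ r)
      ((2 : ℝ) • ∑ k, (C⁻¹ *ᵥ p) k • ContinuousLinearMap.proj (R := ℝ) (φ := fun _ : ι => ℝ) k) p := by
    unfold quadForm
    have h := HasFDerivAt.fun_sum (u := Finset.univ) fun i _ => HasFDerivAt.fun_sum (u := Finset.univ) fun j _ =>
      ((hasFDerivAt_apply (𝕜 := ℝ) (F' := fun _ : ι => ℝ) i p).mul_const (C⁻¹ i j)).mul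
        (hasFDerivAt_apply (𝕜 := ℝ) (F' := fun _ : ι => ℝ) j p)
    refine h.congr_fderiv ?_
    ext v
    simp only [_root_.sum_apply, _root_.smul_apply,
      _root_.add_apply, smul_eq_mul, mulVec, dotProduct, ContinuousLinearMap.proj_apply,
      Finset.sum_mul, Finset.mul_sum, Finset.sum_add_distrib]
    rw [Finset.sum_comm, ← Finset.sum_add_distrib]
    refine Finset.sum_congr rfl fun k _ => ?_
    rw [← Finset.sum_add_distrib]
    refine Finset.sum_congr rfl fun l _ => ?_
    rw [hs l k]
    ring
  unfold gaussPdf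
  have h := ((hQ.const_mul (-(1 / 2))).exp).mul_const
    (Real.sqrt ((2 * Real.pi) ^ Fintype.card ι * C.det))⁻¹
  simp only [div_eq_mul_inv (Real.exp _)]
  refine h.congr_fderiv ?_
  ext v
  simp only [_root_.smul_apply, smul_eq_mul]
  ring

theorem flux_div {C : Matrix ι ι ℝ} (hC : C.PosDef) (G L : Matrix ι ι ℝ) (a : ℝ) (q : ι → ℝ) :
    (∑ k, fderiv ℝ (fun p => G.mulVec p k * gaussPdf C p
              - a * L.mulVec (fun l => p l * gaussPdf C p
                    + fderiv ℝ (fun r => gaussPdf C r) p (Pi.single l 1)) k) q (Pi.single k 1))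
      = gaussPdf C q * ((G - a • L + a • (L * C⁻¹)).trace
          - ((G - a • L + a • (L * C⁻¹)) *ᵥ q) ⬝ᵥ (C⁻¹ *ᵥ q)) := by
  set K := G - a • L + a • (L * C⁻¹) with hK
  have hgrad : ∀ p l, fderiv ℝ (fun r => gaussPdf C r) p (Pi.single l 1)
      = - gaussPdf C p * (C⁻¹ *ᵥ p) l := by
    intro p l
    rw [(hasFDerivAt_gaussPdf_q hC p).fderiv]
    simp [Pi.single_apply]
  have hflux : ∀ p k, G.mulVec p k * gaussPdf C p
              - a * L.mulVec (fun l => p l * gaussPdf C p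
                    + fderiv ℝ (fun r => gaussPdf C r) p (Pi.single l 1)) k
      = (K *ᵥ p) k * gaussPdf C p := by
    intro p k
    have : (fun l => p l * gaussPdf C p
                    + fderiv ℝ (fun r => gaussPdf C r) p (Pi.single l 1))
        = gaussPdf C p • (p - C⁻¹ *ᵥ p) := by
      funext l
      rw [hgrad]
      simp
      ring
    rw [this, hK, mulVec_smul, mulVec_sub, add_mulVec, sub_mulVec, smul_mulVec, smul_mulVec,
      ← mulVec_mulVec]
    simp
    ring
  have hd : ∀ k, fderiv ℝ (fun p => (K *ᵥ p) k * gaussPdf C p) q (Pi.single k 1)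
      = gaussPdf C q * (K k k - (K *ᵥ q) k * (C⁻¹ *ᵥ q) k) := by
    intro k
    have h1 : HasFDerivAt (fun p : ι → ℝ => (K *ᵥ p) k)
        (∑ l, K k l • ContinuousLinearMap.proj (R := ℝ) (φ := fun _ : ι => ℝ) l) q := by
      simp only [mulVec, dotProduct]
      exact HasFDerivAt.fun_sum fun l _ => (hasFDerivAt_apply (𝕜 := ℝ) (F' := fun _ : ι => ℝ) l q).const_mul (K k l)
    rw [(h1.fun_mul (hasFDerivAt_gaussPdf_q hC q)).fderiv]
    simp [Pi.single_apply]
    ring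
  simp only [hflux, hd]
  rw [← Finset.mul_sum, Finset.sum_sub_distrib]
  rfl

theorem algebra_final {C : Matrix ι ι ℝ} (hC : C.PosDef) (G L S : Matrix ι ι ℝ) (a : ℝ) (q : ι → ℝ)
    (hS : S = (2 * a) • L - C * (a • L - G)ᵀ - (a • L - G) * C) :
    (∑ k, ∑ l, ((1 / 2) * ((C⁻¹ *ᵥ q) k * (C⁻¹ *ᵥ q) l) - (1 / 2) * C⁻¹ l k) * S k l)
      + ((G - a • L + a • (L * C⁻¹)).trace
          - ((G - a • L + a • (L * C⁻¹)) *ᵥ q) ⬝ᵥ (C⁻¹ *ᵥ q)) = 0 := by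
  have hu : IsUnit C.det := isUnit_iff_ne_zero.2 hC.det_pos.ne'
  have hCt : Cᵀ = C := by 
    rw [← conjTranspose_eq_transpose_of_trivial]; exact hC.isHermitian.eq
  set v := C⁻¹ *ᵥ q with hv
  have hq : q = C *ᵥ v := by rw [hv, mulVec_mulVec, mul_nonsing_inv _ hu, one_mulVec]
  have e1 : (∑ k, ∑ l, ((1 / 2) * (v k * v l) - (1 / 2) * C⁻¹ l k) * S k l)
      = (1 / 2) * (v ⬝ᵥ (S *ᵥ v)) - (1 / 2) * (C⁻¹ * S).trace := by
    have : (C⁻¹ * S).trace = ∑ k, ∑ l, C⁻¹ l k * S k l := by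
      simp only [trace, diag, mul_apply]
      exact Finset.sum_comm
    rw [this]
    simp only [dotProduct, mulVec, Finset.mul_sum, ← Finset.sum_sub_distrib]
    exact Finset.sum_congr rfl fun c _ => Finset.sum_congr rfl fun c' _ => by ring
  have e2 : v ⬝ᵥ (S *ᵥ v) = 2 * a * (v ⬝ᵥ (L *ᵥ v)) - 2 * (v ⬝ᵥ ((a • L - G) *ᵥ q)) := by
    have h1 : v ⬝ᵥ ((C * (a • L - G)ᵀ) *ᵥ v) = v ⬝ᵥ ((a • L - G) *ᵥ q) := by
      rw [← mulVec_mulVec, dotProduct_mulVec, ← mulVec_transpose, hCt, ← hq, mulVec_transpose,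
        dotProduct_comm, ← dotProduct_mulVec]
    have h2 : v ⬝ᵥ (((a • L - G) * C) *ᵥ v) = v ⬝ᵥ ((a • L - G) *ᵥ q) := by
      rw [← mulVec_mulVec, ← hq]
    rw [hS, sub_mulVec, sub_mulVec, dotProduct_sub, dotProduct_sub, h1, h2, smul_mulVec,
      dotProduct_smul, smul_eq_mul]
    ring
  have e3 : (C⁻¹ * S).trace = 2 * a * (L * C⁻¹).trace - 2 * (a • L - G).trace := by
    have h1 : C⁻¹ * (C * (a • L - G)ᵀ) = (a • L - G)ᵀ := by
      rw [← mul_assoc, nonsing_inv_mul _ hu, one_mul]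
    have h2 : (C⁻¹ * ((a • L - G) * C)).trace = (a • L - G).trace := by
      rw [trace_mul_comm, mul_assoc, mul_nonsing_inv _ hu, mul_one]
    rw [hS, mul_sub, mul_sub, trace_sub, trace_sub, h1, h2, trace_transpose, Matrix.mul_smul, trace_smul,
      trace_mul_comm C⁻¹ L, smul_eq_mul]
    ring
  rw [e1, e2, e3, dotProduct_comm _ v]
  simp only [add_mulVec, sub_mulVec, smul_mulVec, ← mulVec_mulVec, ← hv, dotProduct_add,
    dotProduct_sub, dotProduct_smul, trace_add, trace_sub, trace_smul, smul_eq_mul]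
  ring

end

/-- Invariance of the Gaussian manifold under the Hookean configurational dynamics: if the
conformation tensor `C(t,x)` (block-wise commuting with `L`) solves the Oldroyd-B-type
evolution equation without diffusion, then `f(t,x,q) = Φ(C(t,x),q)` exactly solves the
Hookean Fokker–Planck equation without center-of-mass diffusion. -/
theorem gaussian_exact_solution_hookean {d N : ℕ} (De : ℝ) (hDe : 0 < De)
    (L : Matrix (Fin N × Fin d) (Fin N × Fin d) ℝ)
    (hLdiag : L.IsDiag) (hLpos : ∀ i, 0 < L i i)
    (u : ℝ → (Fin d → ℝ) → (Fin d → ℝ))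
    (hu : ContDiff ℝ 1 (fun p : ℝ × (Fin d → ℝ) => u p.1 p.2))
    (C : ℝ → (Fin d → ℝ) → Matrix (Fin N × Fin d) (Fin N × Fin d) ℝ)
    (hCdiff : ∀ k l, Differentiable ℝ (fun p : ℝ × (Fin d → ℝ) => C p.1 p.2 k l))
    (hCpos : ∀ t x, (C t x).PosDef)
    (hCL : ∀ t x, C t x * L = L * C t x)
    (hCevol : ∀ (t : ℝ) (x : Fin d → ℝ) (k l : Fin N × Fin d),
      deriv (fun τ => C τ x k l) t
        + ∑ i, u t x i * fderiv ℝ (fun y => C t y k l) x (Pi.single i 1)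
      = ((1 / De) • L
          - C t x * ((1 / (2 * De)) • L - (1 : Matrix (Fin N) (Fin N) ℝ) ⊗ₖ jacb u t x)ᵀ
          - ((1 / (2 * De)) • L - (1 : Matrix (Fin N) (Fin N) ℝ) ⊗ₖ jacb u t x) * C t x)
        k l) :
    ∀ (t : ℝ) (x : Fin d → ℝ) (q : Fin N × Fin d → ℝ),
      deriv (fun τ => gaussPdf (C τ x) q) t
        + (∑ i, u t x i * fderiv ℝ (fun y => gaussPdf (C t y) q) x (Pi.single i 1))
        + (∑ k, fderiv ℝ (fun p =>
            ((1 : Matrix (Fin N) (Fin N) ℝ) ⊗ₖ jacb u t x).mulVec p k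
                * gaussPdf (C t x) p
              - (1 / (2 * De)) * L.mulVec (fun l =>
                  p l * gaussPdf (C t x) p
                    + fderiv ℝ (fun r => gaussPdf (C t x) r) p (Pi.single l 1)) k)
            q (Pi.single k 1))
      = 0 := by
  intro t x q
  have hCt : ∀ k l, HasFDerivAt (fun τ : ℝ => C τ x k l) (fderiv ℝ (fun τ : ℝ => C τ x k l) t) t := by
    intro k l
    apply DifferentiableAt.hasFDerivAt
    exact (hCdiff k l (t, x)).comp (f := fun τ : ℝ => (τ, x)) t (by fun_prop)
  have hCx : ∀ k l, HasFDerivAt (fun y => C t y k l) (fderiv ℝ (fun y => C t y k l) x) x := by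
    intro k l
    apply DifferentiableAt.hasFDerivAt
    exact (hCdiff k l (t, x)).comp (f := fun y => (t, y)) x (by fun_prop)
  have ht := hasFDerivAt_gaussPdf_cov (A := fun τ => C τ x) hCt (fun τ => hCpos τ x) q
  have hx := hasFDerivAt_gaussPdf_cov (A := fun y => C t y) hCx (fun y => hCpos t y) q
  rw [flux_div (hCpos t x), ← fderiv_apply_one_eq_deriv, ht.fderiv, hx.fderiv]
  set W : Fin N × Fin d → Fin N × Fin d → ℝ := fun k l =>
    (1 / 2) * (((C t x)⁻¹ *ᵥ q) k * ((C t x)⁻¹ *ᵥ q) l) - (1 / 2) * (C t x)⁻¹ l k with hW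
  have hal := algebra_final (hCpos t x) ((1 : Matrix (Fin N) (Fin N) ℝ) ⊗ₖ jacb u t x) L
    _ (1 / (2 * De)) q rfl
  have h2 : 2 * (1 / (2 * De)) = 1 / De := by field_simp
  rw [h2] at hal
  simp only [← hCevol] at hal
  rw [← mul_zero (gaussPdf (C t x) q), ← hal, mul_add (gaussPdf (C t x) q)]
  congr 1
  simp only [_root_.smul_apply, _root_.sum_apply, smul_eq_mul,
    fderiv_apply_one_eq_deriv, mul_add, Finset.sum_add_distrib]
  congr 1
  simp only [Finset.mul_sum]
  rw [Finset.sum_comm]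
  refine Finset.sum_congr rfl fun k _ => ?_
  rw [Finset.sum_comm]
  refine Finset.sum_congr rfl fun l _ => Finset.sum_congr rfl fun i _ => ?_
  ring
end

section
/- Let d, N ∈ ℕ, set n = N·d, let De > 0 and ε ≥ 0, let L ∈ Matrix n n ℝ be diagonal with strictly positive diagonal entries, and let u : ℝ × (Fin d → ℝ) → (Fin d → ℝ) be continuously differentiable with spatial Jacobian J(t,x)ᵢⱼ = ∂uᵢ/∂xⱼ(t,x); put G(t,x) = (1 : Matrix N N ℝ) ⊗ J(t,x) and M(t,x) = (1/(2·De))·L − G(t,x). Suppose C : ℝ × (Fin d → ℝ) → Matrix n n ℝ is differentiable in t, twice differentiable in x, takes symmetric positive definite values satisfying C(t,x) * L = L * C(t,x), and solves the diffusive evolution equation ∂ₜC + ∑ᵢ uᵢ ∂C/∂xᵢ − ε·∑ᵢ ∂²C/∂xᵢ² = (1/De)·L − C * M(t,x)ᵀ − M(t,x) * C for all (t,x). Define f(t, x, q) = Φ(C(t,x), q) and ρ(t, x, q) = ∑ᵢ [ qᵀ (C⁻¹ Dᵢ)² C⁻¹ q − (1/2)·trace((C⁻¹ Dᵢ)²)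 − (1/4)·( qᵀ C⁻¹ Dᵢ C⁻¹ q − trace(C⁻¹ Dᵢ) )² ], where Dᵢ = ∂C/∂xᵢ(t,x) and C = C(t,x). Then the Fokker–Planck residual of f is exactly ε·ρ·f: for all (t, x, q), ∂ₜf + ∑ᵢ uᵢ ∂f/∂xᵢ − ε·∑ᵢ ∂²f/∂xᵢ² + div_q( G(t,x) q · f − (1/(2·De)) · L • (q · f + ∇_q f) ) = ε · ρ(t, x, q) · f(t, x, q). -/
open Matrix Real Kronecker

/-- The spatial partial derivative `Dᵢ = ∂C/∂xᵢ(t,x)` of a matrix-valued field, entrywise. -/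
noncomputable def matPartialX {ι : Type*} [Fintype ι] {d : ℕ}
    (C : ℝ → (Fin d → ℝ) → Matrix ι ι ℝ) (t : ℝ) (x : Fin d → ℝ) (i : Fin d) :
    Matrix ι ι ℝ :=
  Matrix.of fun k l => fderiv ℝ (fun y => C t y k l) x (Pi.single i 1)

/-- The spatial remainder `ρ(t,x,q)` of the Gaussian ansatz, built from `C = C(t,x)` and its
spatial partial derivatives `Dᵢ = ∂C/∂xᵢ(t,x)`. -/
noncomputable def rhoRem {ι : Type*} [Fintype ι] [DecidableEq ι] {d : ℕ}
    (C : ℝ → (Fin d → ℝ) → Matrix ι ι ℝ) (t : ℝ) (x : Fin d → ℝ) (q : ι → ℝ) : ℝ :=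
  ∑ i : Fin d,
    (quadForm ((C t x)⁻¹ * matPartialX C t x i * (C t x)⁻¹ * matPartialX C t x i * (C t x)⁻¹) q
      - (1 / 2) * (((C t x)⁻¹ * matPartialX C t x i) * ((C t x)⁻¹ * matPartialX C t x i)).trace
      - (1 / 4) * (quadForm ((C t x)⁻¹ * matPartialX C t x i * (C t x)⁻¹) q
          - ((C t x)⁻¹ * matPartialX C t x i).trace) ^ 2)

lemma hasDerivAt_det_aux {ι : Type*} [Fintype ι] [DecidableEq ι] {A : ℝ → Matrix ι ι ℝ}
    {A' : Matrix ι ι ℝ} {t : ℝ} (hA : ∀ k l, HasDerivAt (fun s => A s k l) (A' k l) t) :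
    HasDerivAt (fun s => (A s).det) ((adjugate (A t) * A').trace) t := by
  have h1 : ∀ σ : Equiv.Perm ι, HasDerivAt (fun s => ∏ i, A s (σ i) i)
      (∑ i, (∏ j ∈ Finset.univ.erase i, A t (σ j) j) • A' (σ i) i) t := fun σ =>
    HasDerivAt.fun_finsetProd (u := Finset.univ) (fun i _ => hA (σ i) i)
  have h2 : HasDerivAt (fun s => ∑ σ : Equiv.Perm ι, ((Equiv.Perm.sign σ : ℤ) : ℝ) * ∏ i, A s (σ i) i)
      (∑ σ : Equiv.Perm ι, ((Equiv.Perm.sign σ : ℤ) : ℝ) *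
        (∑ i, (∏ j ∈ Finset.univ.erase i, A t (σ j) j) • A' (σ i) i)) t :=
    HasDerivAt.fun_sum (fun σ _ => (h1 σ).const_mul _)
  have h3 : (fun s => (A s).det) =
      fun s => ∑ σ : Equiv.Perm ι, ((Equiv.Perm.sign σ : ℤ) : ℝ) * ∏ i, A s (σ i) i := by
    funext s; rw [det_apply']
  rw [h3]
  refine h2.congr_deriv ?_
  have h4 : ∀ i, (adjugate (A t) * A') i i = ((A t).updateCol i (fun k => A' k i)).det := by
    intro i
    rw [← cramer_apply, cramer_eq_adjugate_mulVec]; rfl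
  rw [trace]
  simp only [diag_apply, h4, det_apply']
  rw [Finset.sum_comm]
  refine Finset.sum_congr rfl fun σ _ => ?_
  rw [Finset.mul_sum]
  refine Finset.sum_congr rfl fun i _ => ?_
  congr 1
  rw [← Finset.prod_erase_mul _ _ (Finset.mem_univ i)]
  simp only [updateCol_self, smul_eq_mul]
  congr 1
  refine Finset.prod_congr rfl fun j hj => ?_
  rw [updateCol_ne (Finset.ne_of_mem_erase hj)]

lemma contDiff_det_aux {E ι : Type*} [NormedAddCommGroup E] [NormedSpace ℝ E] [Fintype ι]
    [DecidableEq ι] {A : E → Matrix ι ι ℝ} {n : WithTop ℕ∞}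
    (hA : ∀ k l, ContDiff ℝ n (fun s => A s k l)) : ContDiff ℝ n (fun s => (A s).det) := by
  simp only [det_apply']
  fun_prop

lemma inv_entry_aux {ι : Type*} [Fintype ι] [DecidableEq ι] (A : Matrix ι ι ℝ) (k l : ι) :
    A⁻¹ k l = A.det⁻¹ * (A.updateRow l (Pi.single k 1)).det := by
  rw [inv_def, Matrix.smul_apply, adjugate_apply, Ring.inverse_eq_inv', smul_eq_mul]

lemma contDiff_inv_aux {E ι : Type*} [NormedAddCommGroup E] [NormedSpace ℝ E] [Fintype ι]
    [DecidableEq ι] {A : E → Matrix ι ι ℝ} {n : WithTop ℕ∞}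
    (hA : ∀ k l, ContDiff ℝ n (fun s => A s k l)) (h0 : ∀ s, (A s).det ≠ 0) (k l : ι) :
    ContDiff ℝ n (fun s => (A s)⁻¹ k l) := by
  simp only [inv_entry_aux]
  refine ((contDiff_det_aux hA).inv h0).mul (contDiff_det_aux fun i j => ?_)
  by_cases h : i = l
  · subst h; simp only [updateRow_self]; exact contDiff_const
  · simp only [updateRow_ne h]; exact hA i j

lemma hasDerivAt_mul_aux {ι : Type*} [Fintype ι] {A B : ℝ → Matrix ι ι ℝ}
    {A' B' : Matrix ι ι ℝ} {t : ℝ} (hA : ∀ k l, HasDerivAt (fun s => A s k l) (A' k l) t)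
    (hB : ∀ k l, HasDerivAt (fun s => B s k l) (B' k l) t) (k l : ι) :
    HasDerivAt (fun s => (A s * B s) k l) ((A' * B t + A t * B') k l) t := by
  simp only [Matrix.mul_apply, Matrix.add_apply, ← Finset.sum_add_distrib]
  exact HasDerivAt.fun_sum (fun j _ => (hA k j).mul (hB j l))

lemma hasDerivAt_inv_aux {ι : Type*} [Fintype ι] [DecidableEq ι] {A : ℝ → Matrix ι ι ℝ}
    {A' : Matrix ι ι ℝ} {t : ℝ} (hA : ∀ k l, HasDerivAt (fun s => A s k l) (A' k l) t)
    (h0 : ∀ s, (A s).det ≠ 0) (k l : ι) :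
    HasDerivAt (fun s => (A s)⁻¹ k l) ((-((A t)⁻¹ * A' * (A t)⁻¹)) k l) t := by
  have hd : ∀ k l, DifferentiableAt ℝ (fun s => (A s)⁻¹ k l) t := by
    intro k l
    simp only [inv_entry_aux]
    refine ((hasDerivAt_det_aux hA).differentiableAt.inv (h0 t)).mul ?_
    refine (hasDerivAt_det_aux (A' := A'.updateRow l 0) fun i j => ?_).differentiableAt
    by_cases h : i = l
    · subst h; simp only [updateRow_self]; exact hasDerivAt_const _ _
    · simp only [updateRow_ne h]; exact hA i j
  set B' : Matrix ι ι ℝ := Matrix.of fun k l => deriv (fun s => (A s)⁻¹ k l) t with hB'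
  have hB : ∀ k l, HasDerivAt (fun s => (A s)⁻¹ k l) (B' k l) t :=
    fun k l => (hd k l).hasDerivAt
  have hz : B' * A t + (A t)⁻¹ * A' = 0 := by
    ext i j
    have h1 := hasDerivAt_mul_aux hB hA i j
    have h2 : (fun s => ((A s)⁻¹ * A s) i j) = fun _ => (1 : Matrix ι ι ℝ) i j := by
      funext s; rw [nonsing_inv_mul _ (isUnit_iff_ne_zero.2 (h0 s))]
    rw [h2] at h1
    exact h1.unique (hasDerivAt_const _ _)
  have : B' = -((A t)⁻¹ * A' * (A t)⁻¹) := by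
    rw [← neg_mul, ← eq_neg_of_add_eq_zero_left hz, Matrix.mul_assoc,
      mul_nonsing_inv _ (isUnit_iff_ne_zero.2 (h0 t)), Matrix.mul_one]
  rw [← this]; exact hB k l

lemma hasDerivAt_quadForm_aux {ι : Type*} [Fintype ι] {A : ℝ → Matrix ι ι ℝ}
    {A' : Matrix ι ι ℝ} {t : ℝ} (hA : ∀ k l, HasDerivAt (fun s => A s k l) (A' k l) t)
    (q : ι → ℝ) : HasDerivAt (fun s => quadForm (A s) q) (quadForm A' q) t := by
  unfold quadForm
  exact HasDerivAt.fun_sum fun i _ => HasDerivAt.fun_sum fun j _ =>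
    ((hA i j).const_mul (q i)).mul_const (q j)

lemma hasDerivAt_trace_aux {ι : Type*} [Fintype ι] {A : ℝ → Matrix ι ι ℝ}
    {A' : Matrix ι ι ℝ} {t : ℝ} (hA : ∀ k l, HasDerivAt (fun s => A s k l) (A' k l) t) :
    HasDerivAt (fun s => (A s).trace) A'.trace t := by
  simp only [trace, diag_apply]
  exact HasDerivAt.fun_sum fun i _ => hA i i

/-- logarithmic derivative of the density in the covariance direction `D` -/
noncomputable def logDir {ι : Type*} [Fintype ι] [DecidableEq ι]
    (C D : Matrix ι ι ℝ) (q : ι → ℝ) : ℝ :=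
  (1 / 2) * (quadForm (C⁻¹ * D * C⁻¹) q - (C⁻¹ * D).trace)

lemma quadForm_neg_aux {ι : Type*} [Fintype ι] (A : Matrix ι ι ℝ) (q : ι → ℝ) :
    quadForm (-A) q = - quadForm A q := by
  simp [quadForm]

lemma quadForm_add_aux {ι : Type*} [Fintype ι] (A B : Matrix ι ι ℝ) (q : ι → ℝ) :
    quadForm (A + B) q = quadForm A q + quadForm B q := by
  simp [quadForm, mul_add, add_mul, Finset.sum_add_distrib]

lemma quadForm_smul_aux {ι : Type*} [Fintype ι] (c : ℝ) (A : Matrix ι ι ℝ) (q : ι → ℝ) :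
    quadForm (c • A) q = c * quadForm A q := by
  simp only [quadForm, Finset.mul_sum, Matrix.smul_apply, smul_eq_mul]
  refine Finset.sum_congr rfl fun i _ => Finset.sum_congr rfl fun j _ => by ring

lemma quadForm_transpose_aux {ι : Type*} [Fintype ι] (A : Matrix ι ι ℝ) (q : ι → ℝ) :
    quadForm Aᵀ q = quadForm A q := by
  simp only [quadForm, transpose_apply]
  rw [Finset.sum_comm]
  refine Finset.sum_congr rfl fun i _ => Finset.sum_congr rfl fun j _ => by ring

lemma hasDerivAt_gaussPdf_aux {ι : Type*} [Fintype ι] [DecidableEq ι] {A : ℝ → Matrix ι ι ℝ}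
    {A' : Matrix ι ι ℝ} {t : ℝ} (hA : ∀ k l, HasDerivAt (fun s => A s k l) (A' k l) t)
    (h0 : ∀ s, 0 < (A s).det) (q : ι → ℝ) :
    HasDerivAt (fun s => gaussPdf (A s) q) (gaussPdf (A t) q * logDir (A t) A' q) t := by
  have hi := hasDerivAt_quadForm_aux (hasDerivAt_inv_aux hA (fun s => (h0 s).ne')) q
  have hd := hasDerivAt_det_aux hA
  have hpos : 0 < (2 * Real.pi) ^ Fintype.card ι * (A t).det := mul_pos (by positivity) (h0 t)
  have hs := (hd.const_mul ((2 * Real.pi) ^ Fintype.card ι)).sqrt hpos.ne'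
  have he := (hi.const_mul (-(1 / 2))).exp
  unfold gaussPdf
  refine (he.fun_div hs (Real.sqrt_pos.2 hpos).ne').congr_deriv ?_
  have htr : (adjugate (A t) * A').trace = (A t).det * ((A t)⁻¹ * A').trace := by
    rw [inv_def, Matrix.smul_mul, trace_smul, Ring.inverse_eq_inv', smul_eq_mul,
      mul_inv_cancel_left₀ (h0 t).ne']
  rw [htr, quadForm_neg_aux, logDir]
  have hsq := Real.sq_sqrt hpos.le
  have hsp := Real.sqrt_pos.2 hpos
  set S := √((2 * Real.pi) ^ Fintype.card ι * (A t).det)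
  rw [← mul_assoc ((2 * Real.pi) ^ Fintype.card ι), ← hsq]
  field_simp

lemma contDiff_gaussPdf_aux {E ι : Type*} [NormedAddCommGroup E] [NormedSpace ℝ E] [Fintype ι]
    [DecidableEq ι] {A : E → Matrix ι ι ℝ} {n : WithTop ℕ∞}
    (hA : ∀ k l, ContDiff ℝ n (fun s => A s k l)) (h0 : ∀ s, 0 < (A s).det) (q : ι → ℝ) :
    ContDiff ℝ n (fun s => gaussPdf (A s) q) := by
  have h1 := contDiff_inv_aux hA (fun s => (h0 s).ne')
  have h2 := contDiff_det_aux hA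
  have h3 : ∀ s, 0 < (2 * Real.pi) ^ Fintype.card ι * (A s).det :=
    fun s => mul_pos (by positivity) (h0 s)
  have h4 : ContDiff ℝ n (fun s => quadForm (A s)⁻¹ q) := by
    unfold quadForm
    exact ContDiff.sum fun i _ => ContDiff.sum fun j _ =>
      (contDiff_const.mul (h1 i j)).mul contDiff_const
  have h5 : ContDiff ℝ n (fun s => √((2 * Real.pi) ^ Fintype.card ι * (A s).det)) :=
    (contDiff_const.mul h2).sqrt fun s => (h3 s).ne'
  have h6 : ContDiff ℝ n (fun s => Real.exp (-(1 / 2) * quadForm (A s)⁻¹ q)) :=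
    (contDiff_const.mul h4).exp
  exact h6.div h5 fun s => (Real.sqrt_pos.2 (h3 s)).ne'

lemma hasDerivAt_logDir_aux {ι : Type*} [Fintype ι] [DecidableEq ι] {A D : ℝ → Matrix ι ι ℝ}
    {A' D' : Matrix ι ι ℝ} {t : ℝ} (hA : ∀ k l, HasDerivAt (fun s => A s k l) (A' k l) t)
    (hD : ∀ k l, HasDerivAt (fun s => D s k l) (D' k l) t)
    (h0 : ∀ s, 0 < (A s).det) (q : ι → ℝ) (hAD : A' = D t) :
    HasDerivAt (fun s => logDir (A s) (D s) q)
      (logDir (A t) D' q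
        - quadForm ((A t)⁻¹ * D t * (A t)⁻¹ * D t * (A t)⁻¹) q
        + (1 / 2) * (((A t)⁻¹ * D t) * ((A t)⁻¹ * D t)).trace) t := by
  subst hAD
  have hi := hasDerivAt_inv_aux hA (fun s => (h0 s).ne')
  have h1 := hasDerivAt_mul_aux hi hD
  have h2 := hasDerivAt_mul_aux h1 hi
  have h3 := ((hasDerivAt_quadForm_aux h2 q).sub (hasDerivAt_trace_aux h1)).const_mul (1 / 2)
  unfold logDir
  refine h3.congr_deriv ?_
  simp only [neg_mul, Matrix.mul_neg, Matrix.add_mul, trace_add, trace_neg, quadForm_add_aux,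
    quadForm_neg_aux, Matrix.mul_assoc]
  ring

lemma fderiv_line_aux {ι : Type*} [Fintype ι] {F : (ι → ℝ) → ℝ} {x v : ι → ℝ} {F' : ℝ}
    (hF : DifferentiableAt ℝ F x) (h : HasDerivAt (fun s : ℝ => F (x + s • v)) F' 0) :
    fderiv ℝ F x v = F' := by
  rw [← hF.lineDeriv_eq_fderiv, lineDeriv]
  exact h.deriv

lemma line_hasDerivAt_aux {ι : Type*} [Fintype ι] {F : (ι → ℝ) → ℝ} (x v : ι → ℝ)
    (hF : DifferentiableAt ℝ F x) :
    HasDerivAt (fun s : ℝ => F (x + s • v)) (fderiv ℝ F x v) 0 := by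
  rw [← hF.lineDeriv_eq_fderiv]
  exact hF.lineDifferentiableAt.hasLineDerivAt

lemma fderiv_gaussPdf_x_aux {ι : Type*} [Fintype ι] [DecidableEq ι] {d : ℕ}
    {C : (Fin d → ℝ) → Matrix ι ι ℝ} (hC : ∀ k l, ContDiff ℝ 2 (fun y => C y k l))
    (h0 : ∀ y, 0 < (C y).det) (q : ι → ℝ) (x v : Fin d → ℝ) :
    fderiv ℝ (fun y => gaussPdf (C y) q) x v =
      gaussPdf (C x) q * logDir (C x) (Matrix.of fun k l => fderiv ℝ (fun y => C y k l) x v) q := by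
  refine fderiv_line_aux ((contDiff_gaussPdf_aux hC h0 q).differentiable (by norm_num) x) ?_
  have := hasDerivAt_gaussPdf_aux (A := fun s : ℝ => C (x + s • v)) (t := 0)
    (A' := Matrix.of fun k l => fderiv ℝ (fun y => C y k l) x v)
    (fun k l => line_hasDerivAt_aux x v ((hC k l).differentiable (by norm_num) x))
    (fun s => h0 _) q
  simpa using this

lemma fderiv2_gaussPdf_x_aux {ι : Type*} [Fintype ι] [DecidableEq ι] {d : ℕ}
    {C : (Fin d → ℝ) → Matrix ι ι ℝ} (hC : ∀ k l, ContDiff ℝ 2 (fun y => C y k l))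
    (h0 : ∀ y, 0 < (C y).det) (q : ι → ℝ) (x v : Fin d → ℝ) (D D2 : Matrix ι ι ℝ)
    (hD : D = Matrix.of fun k l => fderiv ℝ (fun y => C y k l) x v)
    (hD2 : D2 = Matrix.of fun k l => fderiv ℝ (fun y => fderiv ℝ (fun z => C z k l) y v) x v) :
    fderiv ℝ (fun y => fderiv ℝ (fun z => gaussPdf (C z) q) y v) x v =
      gaussPdf (C x) q * (logDir (C x) D2 q - (quadForm ((C x)⁻¹ * D * (C x)⁻¹ * D * (C x)⁻¹) q
      - (1 / 2) * (((C x)⁻¹ * D) * ((C x)⁻¹ * D)).trace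
      - (1 / 4) * (quadForm ((C x)⁻¹ * D * (C x)⁻¹) q - ((C x)⁻¹ * D).trace) ^ 2)) := by
  have key : ∀ G : (Fin d → ℝ) → ℝ, ContDiff ℝ 2 G →
      DifferentiableAt ℝ (fun y => fderiv ℝ G y v) x := by
    intro G hG
    exact (((hG.fderiv_right (m := 1) (by norm_num)).clm_apply contDiff_const).differentiable
      (by norm_num)) x
  refine fderiv_line_aux (key _ (contDiff_gaussPdf_aux hC h0 q)) ?_
  simp only [fderiv_gaussPdf_x_aux hC h0]
  have hA : ∀ k l, HasDerivAt (fun s : ℝ => C (x + s • v) k l) (D k l) 0 := fun k l => by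
    rw [hD]; exact line_hasDerivAt_aux x v ((hC k l).differentiable (by norm_num) x)
  have h1 := hasDerivAt_gaussPdf_aux (A := fun s : ℝ => C (x + s • v)) (t := 0) hA
    (fun s => h0 _) q
  have h2 := hasDerivAt_logDir_aux (A := fun s : ℝ => C (x + s • v)) (t := 0)
    (D := fun s : ℝ => Matrix.of fun k l => fderiv ℝ (fun y => C y k l) (x + s • v) v) (D' := D2) hA
    (fun k l => by
      rw [hD2]
      exact line_hasDerivAt_aux (F := fun y => fderiv ℝ (fun z => C z k l) y v) x v
        (key _ (hC k l)))
    (fun s => h0 _) q (by rw [hD]; simp)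
  refine (h1.mul h2).congr_deriv ?_
  simp only [zero_smul, add_zero, ← hD]
  unfold logDir
  ring

lemma hasDerivAt_coord_aux {ι : Type*} [Fintype ι] (p v : ι → ℝ) (i : ι) :
    HasDerivAt (fun s : ℝ => (p + s • v) i) (v i) 0 := by
  simp only [Pi.add_apply, Pi.smul_apply, smul_eq_mul]
  simpa using ((hasDerivAt_id (0 : ℝ)).mul_const (v i)).const_add (p i)

lemma hasDerivAt_quadForm_q_aux {ι : Type*} [Fintype ι] [DecidableEq ι] (B : Matrix ι ι ℝ)
    (hB : Bᵀ = B) (p : ι → ℝ) (l : ι) :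
    HasDerivAt (fun s : ℝ => quadForm B (p + s • Pi.single l 1)) (2 * (B *ᵥ p) l) 0 := by
  unfold quadForm
  have h : HasDerivAt (fun s : ℝ => ∑ i, ∑ j, (p + s • (Pi.single l 1 : ι → ℝ)) i * B i j *
      (p + s • (Pi.single l 1 : ι → ℝ)) j) (∑ i, ∑ j, ((Pi.single l 1 : ι → ℝ) i * B i j * p j +
        p i * B i j * (Pi.single l 1 : ι → ℝ) j)) 0 := by
    refine HasDerivAt.fun_sum fun i _ => HasDerivAt.fun_sum fun j _ => ?_
    have := ((hasDerivAt_coord_aux p (Pi.single l 1) i).mul_const (B i j)).fun_mul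
      (hasDerivAt_coord_aux p (Pi.single l 1) j)
    simpa using this
  refine h.congr_deriv ?_
  simp only [Finset.sum_add_distrib, Pi.single_apply, mulVec, dotProduct, ite_mul, mul_ite, one_mul,
    zero_mul, mul_one, mul_zero, Finset.sum_ite_eq', Finset.mem_univ, if_true]
  rw [Finset.sum_eq_single l (by intro b _ hb; simp [hb]) (by simp)]
  simp only [if_true, two_mul]
  congr 1
  refine Finset.sum_congr rfl fun i _ => ?_
  conv_lhs => rw [← hB, transpose_apply]
  ring

lemma differentiable_quadForm_aux {ι : Type*} [Fintype ι] (B : Matrix ι ι ℝ) :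
    Differentiable ℝ (fun p => quadForm B p) := by
  unfold quadForm
  fun_prop

lemma differentiable_gaussPdf_q_aux {ι : Type*} [Fintype ι] [DecidableEq ι] (C : Matrix ι ι ℝ) :
    Differentiable ℝ (fun p => gaussPdf C p) := by
  have := differentiable_quadForm_aux C⁻¹
  unfold gaussPdf
  simp only [div_eq_mul_inv]
  exact ((this.const_mul _).exp).mul_const _

lemma hasDerivAt_gaussPdf_q_aux {ι : Type*} [Fintype ι] [DecidableEq ι] (C : Matrix ι ι ℝ)
    (hC : (C⁻¹)ᵀ = C⁻¹) (p : ι → ℝ) (l : ι) :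
    HasDerivAt (fun s : ℝ => gaussPdf C (p + s • Pi.single l 1))
      (-(gaussPdf C p * (C⁻¹ *ᵥ p) l)) 0 := by
  unfold gaussPdf
  refine ((((hasDerivAt_quadForm_q_aux C⁻¹ hC p l).const_mul (-(1 / 2))).exp).div_const _).congr_deriv ?_
  simp only [zero_smul, add_zero]
  ring

lemma fderiv_gaussPdf_q_aux {ι : Type*} [Fintype ι] [DecidableEq ι] (C : Matrix ι ι ℝ)
    (hC : (C⁻¹)ᵀ = C⁻¹) (p : ι → ℝ) (l : ι) :
    fderiv ℝ (fun r => gaussPdf C r) p (Pi.single l 1) = -(gaussPdf C p * (C⁻¹ *ᵥ p) l) :=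
  fderiv_line_aux (differentiable_gaussPdf_q_aux C p) (hasDerivAt_gaussPdf_q_aux C hC p l)

lemma fderiv_flux_aux {ι : Type*} [Fintype ι] [DecidableEq ι] (C H : Matrix ι ι ℝ)
    (hC : (C⁻¹)ᵀ = C⁻¹) (q : ι → ℝ) (k : ι) :
    fderiv ℝ (fun p => gaussPdf C p * (H *ᵥ p) k) q (Pi.single k 1) =
      gaussPdf C q * (H k k - (C⁻¹ *ᵥ q) k * (H *ᵥ q) k) := by
  have hd : Differentiable ℝ (fun p : ι → ℝ => (H *ᵥ p) k) := by
    simp only [mulVec, dotProduct]; fun_prop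
  refine fderiv_line_aux ((differentiable_gaussPdf_q_aux C q).mul (hd q)) ?_
  have h1 : HasDerivAt (fun s : ℝ => (H *ᵥ (q + s • Pi.single k 1)) k) (H k k) 0 := by
    have : HasDerivAt (fun s : ℝ => ∑ j, H k j * (q + s • (Pi.single k 1 : ι → ℝ)) j)
        (∑ j, H k j * (Pi.single k 1 : ι → ℝ) j) 0 :=
      HasDerivAt.fun_sum fun j _ => (hasDerivAt_coord_aux q (Pi.single k 1) j).const_mul (H k j)
    exact this.congr_deriv (by simp [Pi.single_apply])
  refine ((hasDerivAt_gaussPdf_q_aux C hC q k).fun_mul h1).congr_deriv ?_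
  simp only [zero_smul, add_zero]
  ring

lemma quadForm_eq_dot_aux {ι : Type*} [Fintype ι] (B : Matrix ι ι ℝ) (q : ι → ℝ) :
    quadForm B q = q ⬝ᵥ B *ᵥ q := by
  simp only [quadForm, dotProduct, mulVec, Finset.mul_sum, mul_assoc]

lemma div_flux_aux {ι : Type*} [Fintype ι] [DecidableEq ι] (C G L : Matrix ι ι ℝ) (c : ℝ)
    (hC : (C⁻¹)ᵀ = C⁻¹) (q : ι → ℝ) :
    (∑ k, fderiv ℝ (fun p => G.mulVec p k * gaussPdf C p
              - c * L.mulVec (fun l => p l * gaussPdf C p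
                    + fderiv ℝ (fun r => gaussPdf C r) p (Pi.single l 1)) k)
            q (Pi.single k 1)) =
      gaussPdf C q * ((G - c • (L - L * C⁻¹)).trace
        - quadForm (C⁻¹ * (G - c • (L - L * C⁻¹))) q) := by
  have h : ∀ k, (fun p => G.mulVec p k * gaussPdf C p
              - c * L.mulVec (fun l => p l * gaussPdf C p
                    + fderiv ℝ (fun r => gaussPdf C r) p (Pi.single l 1)) k) =
      fun p => gaussPdf C p * ((G - c • (L - L * C⁻¹)) *ᵥ p) k := by
    intro k
    funext p
    simp only [fderiv_gaussPdf_q_aux C hC]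
    have : (fun l => p l * gaussPdf C p + -(gaussPdf C p * (C⁻¹ *ᵥ p) l)) =
        gaussPdf C p • (p - C⁻¹ *ᵥ p) := by
      funext l; simp only [Pi.smul_apply, Pi.sub_apply, smul_eq_mul]; ring
    rw [this]
    simp only [mulVec_smul, mulVec_sub, sub_mulVec, smul_mulVec, mulVec_mulVec, Pi.smul_apply,
      Pi.sub_apply, smul_eq_mul]
    ring
  simp only [h, fderiv_flux_aux C _ hC]
  rw [← Finset.mul_sum, Finset.sum_sub_distrib]
  congr 2
  rw [quadForm_eq_dot_aux, ← mulVec_mulVec, dotProduct_mulVec, ← mulVec_transpose, hC]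
  rfl

/-- `logDir` as a linear map in the direction. -/
noncomputable def logDirL {ι : Type*} [Fintype ι] [DecidableEq ι]
    (C : Matrix ι ι ℝ) (q : ι → ℝ) : Matrix ι ι ℝ →ₗ[ℝ] ℝ where
  toFun D := logDir C D q
  map_add' A B := by
    simp only [logDir, Matrix.mul_add, Matrix.add_mul, quadForm_add_aux, trace_add]; ring
  map_smul' c A := by
    simp only [logDir, Matrix.mul_smul, Matrix.smul_mul, quadForm_smul_aux, trace_smul,
      smul_eq_mul, RingHom.id_apply]; ring

lemma quadForm_sub_aux {ι : Type*} [Fintype ι] (A B : Matrix ι ι ℝ) (q : ι → ℝ) :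
    quadForm (A - B) q = quadForm A q - quadForm B q := by
  rw [sub_eq_add_neg, quadForm_add_aux, quadForm_neg_aux, sub_eq_add_neg]

lemma cancel_aux {ι : Type*} [Fintype ι] [DecidableEq ι] (C G L : Matrix ι ι ℝ) (De : ℝ)
    (hC : (C⁻¹)ᵀ = C⁻¹) (h0 : C.det ≠ 0) (q : ι → ℝ) :
    logDir C ((1 / De) • L - C * ((1 / (2 * De)) • L - G)ᵀ - ((1 / (2 * De)) • L - G) * C) q
      + ((G - (1 / (2 * De)) • (L - L * C⁻¹)).trace
        - quadForm (C⁻¹ * (G - (1 / (2 * De)) • (L - L * C⁻¹))) q) = 0 := by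
  have hu := isUnit_iff_ne_zero.2 h0
  have e1 : ∀ X : Matrix ι ι ℝ, C⁻¹ * (C * X) = X := fun X => by
    rw [← Matrix.mul_assoc, nonsing_inv_mul _ hu, Matrix.one_mul]
  have e2 : C * C⁻¹ = 1 := mul_nonsing_inv _ hu
  set M := (1 / (2 * De)) • L - G with hM
  have t1 : (C⁻¹ * (M * C)).trace = M.trace := by
    rw [trace_mul_comm, Matrix.mul_assoc, e2, Matrix.mul_one]
  have q1 : quadForm (Mᵀ * C⁻¹) q = quadForm (C⁻¹ * M) q := by
    rw [← quadForm_transpose_aux, transpose_mul, transpose_transpose, hC]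
  have hG : G - (1 / (2 * De)) • (L - L * C⁻¹) = (1 / (2 * De)) • (L * C⁻¹) - M := by
    rw [hM, smul_sub]; abel
  rw [hG]
  unfold logDir
  simp only [Matrix.mul_sub, Matrix.sub_mul, e1, trace_sub, t1, quadForm_sub_aux, q1,
    trace_transpose, Matrix.mul_assoc, e2, Matrix.mul_one, Matrix.mul_smul, Matrix.smul_mul,
    quadForm_smul_aux, trace_smul, smul_eq_mul]
  rw [trace_mul_comm L]
  have : 1 / (2 * De) = (1 / 2) * (1 / De) := by rw [one_div_mul_one_div]
  rw [this]
  ring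

/-- Variational (Dirac–Frenkel) approximation property of the Gaussian family with diffusive
Oldroyd-B conformation dynamics: the Fokker–Planck residual of `f(t,x,q) = Φ(C(t,x),q)` is
exactly `ε·ρ·f`, which is orthogonal to the Gaussian tangent space. -/
theorem gaussian_residual_hookean_diffusive {d N : ℕ} (De ε : ℝ) (hDe : 0 < De) (hε : 0 ≤ ε)
    (L : Matrix (Fin N × Fin d) (Fin N × Fin d) ℝ)
    (hLdiag : L.IsDiag) (hLpos : ∀ i, 0 < L i i)
    (u : ℝ → (Fin d → ℝ) → (Fin d → ℝ))
    (hu : ContDiff ℝ 1 (fun p : ℝ × (Fin d → ℝ) => u p.1 p.2))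
    (C : ℝ → (Fin d → ℝ) → Matrix (Fin N × Fin d) (Fin N × Fin d) ℝ)
    (hCt : ∀ (x : Fin d → ℝ) (k l : Fin N × Fin d),
      Differentiable ℝ (fun τ => C τ x k l))
    (hCx : ∀ (t : ℝ) (k l : Fin N × Fin d), ContDiff ℝ 2 (fun y => C t y k l))
    (hCpos : ∀ t x, (C t x).PosDef)
    (hCL : ∀ t x, C t x * L = L * C t x)
    (hCevol : ∀ (t : ℝ) (x : Fin d → ℝ) (k l : Fin N × Fin d),
      deriv (fun τ => C τ x k l) t
        + (∑ i, u t x i * fderiv ℝ (fun y => C t y k l) x (Pi.single i 1))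
        - ε * ∑ i, fderiv ℝ (fun y => fderiv ℝ (fun z => C t z k l) y (Pi.single i 1)) x
            (Pi.single i 1)
      = ((1 / De) • L
          - C t x * ((1 / (2 * De)) • L - (1 : Matrix (Fin N) (Fin N) ℝ) ⊗ₖ jacb u t x)ᵀ
          - ((1 / (2 * De)) • L - (1 : Matrix (Fin N) (Fin N) ℝ) ⊗ₖ jacb u t x) * C t x)
        k l) :
    ∀ (t : ℝ) (x : Fin d → ℝ) (q : Fin N × Fin d → ℝ),
      deriv (fun τ => gaussPdf (C τ x) q) t
        + (∑ i, u t x i * fderiv ℝ (fun y => gaussPdf (C t y) q) x (Pi.single i 1))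
        - ε * (∑ i, fderiv ℝ
            (fun y => fderiv ℝ (fun z => gaussPdf (C t z) q) y (Pi.single i 1)) x
            (Pi.single i 1))
        + (∑ k, fderiv ℝ (fun p =>
            ((1 : Matrix (Fin N) (Fin N) ℝ) ⊗ₖ jacb u t x).mulVec p k
                * gaussPdf (C t x) p
              - (1 / (2 * De)) * L.mulVec (fun l =>
                  p l * gaussPdf (C t x) p
                    + fderiv ℝ (fun r => gaussPdf (C t x) r) p (Pi.single l 1)) k)
            q (Pi.single k 1))
      = ε * rhoRem C t x q * gaussPdf (C t x) q := by

  intro t x q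
  have h0 : ∀ t x, 0 < (C t x).det := fun t x => (hCpos t x).det_pos
  have hsym : ((C t x)⁻¹)ᵀ = (C t x)⁻¹ := by
    have h := (hCpos t x).isHermitian
    rw [IsHermitian, conjTranspose_eq_transpose_of_trivial] at h
    rw [transpose_nonsing_inv, h]
  rw [div_flux_aux _ _ _ _ hsym]
  have ht := (hasDerivAt_gaussPdf_aux (A := fun τ => C τ x) (t := t)
    (A' := Matrix.of fun k l => deriv (fun τ => C τ x k l) t)
    (fun k l => (hCt x k l t).hasDerivAt) (fun s => h0 s x) q).deriv
  rw [ht]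
  have h1 : ∀ i, fderiv ℝ (fun y => gaussPdf (C t y) q) x (Pi.single i 1) =
      gaussPdf (C t x) q * logDir (C t x) (matPartialX C t x i) q :=
    fun i => fderiv_gaussPdf_x_aux (hCx t) (h0 t) q x (Pi.single i 1)
  have h2 := fun i => fderiv2_gaussPdf_x_aux (hCx t) (h0 t) q x (Pi.single i 1)
    (matPartialX C t x i) _ rfl rfl
  simp only [h1, h2]
  have hR : (Matrix.of fun k l => deriv (fun τ => C τ x k l) t)
      + (∑ i, u t x i • matPartialX C t x i)
      - ε • ∑ i, (Matrix.of fun k l => fderiv ℝ (fun y => fderiv ℝ (fun z => C t z k l) y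
          (Pi.single i 1)) x (Pi.single i 1))
      = ((1 / De) • L
          - C t x * ((1 / (2 * De)) • L - (1 : Matrix (Fin N) (Fin N) ℝ) ⊗ₖ jacb u t x)ᵀ
          - ((1 / (2 * De)) • L - (1 : Matrix (Fin N) (Fin N) ℝ) ⊗ₖ jacb u t x) * C t x) := by
    ext k l
    rw [← hCevol t x k l]
    simp only [Matrix.add_apply, Matrix.sub_apply, Matrix.smul_apply, Matrix.sum_apply,
      smul_eq_mul, matPartialX, Matrix.of_apply]
  have hc := cancel_aux (C t x) ((1 : Matrix (Fin N) (Fin N) ℝ) ⊗ₖ jacb u t x) L De hsym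
    (h0 t x).ne' q
  rw [← hR] at hc
  have hl : ∀ D, logDir (C t x) D q = logDirL (C t x) q D := fun _ => rfl
  rw [hl] at hc
  simp only [map_add, map_sub, map_smul, map_sum, smul_eq_mul] at hc
  simp only [← hl] at hc
  rw [rhoRem]
  simp only [mul_sub (gaussPdf (C t x) q) (logDir _ _ _), Finset.sum_sub_distrib (s := Finset.univ)
    (f := fun i => gaussPdf (C t x) q * logDir _ _ _), ← Finset.mul_sum,
    mul_left_comm _ (gaussPdf (C t x) q) (logDir _ _ _)]
  linear_combination (gaussPdf (C t x) q) * hc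
end
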